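/- (Theorem 2.2, strongly monotone case) Assume hypotheses (H₀) and that A is strongly monotone with parameter α > 0, i.e. ⟨x* − y*, x − y⟩ ≥ α‖x − y‖² whenever x* ∈ A x and y* ∈ A y. Then S consists of a single point u, and every sequence (x_n) generated by the (SFBP) algorithm converges strongly (in norm) to u as n → ∞. -/

import Mathlib

open Filter Topology
open scoped RealInnerProductSpace

variable {H : Type*} [NormedAddCommGroup H] [InnerProductSpace ℝ H] [CompleteSpace H]

/-- A set-valued operator `A : H → Set H` is monotone. -/
def MonotoneOp (A : H → Set H) : Prop :=
  ∀ x y x' y', x' ∈ A x → y' ∈ A y → 0 ≤ ⟪x' - y', x - y⟫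

/-- A set-valued operator is maximal monotone: it is monotone and its graph is not
properly contained in the graph of any other monotone operator. -/
def MaxMonotoneOp (A : H → Set H) : Prop :=
  MonotoneOp A ∧ ∀ B : H → Set H, MonotoneOp B → (∀ x, A x ⊆ B x) → B = A

/-- The (outward) normal cone to a set `C` at `x`: empty when `x ∉ C`. -/
def nCone (C : Set H) (x : H) : Set H :=
  {p | x ∈ C ∧ ∀ c ∈ C, ⟪p, c - x⟫ ≤ 0}

/-- Subdifferential of an extended-real-valued function. -/
def ESubdiff (F : H → EReal) (x : H) : Set H :=
  {p | ∀ y, F x + ((⟪p, y - x⟫ : ℝ) : EReal) ≤ F y}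

/-- Fenchel conjugate of an extended-real-valued function. -/
noncomputable def fenchelConj (F : H → EReal) (p : H) : EReal :=
  ⨆ y, (((⟪y, p⟫ : ℝ) : EReal) - F y)

/-- Support function of a set. -/
noncomputable def suppFun (C : Set H) (p : H) : EReal :=
  ⨆ c : C, ((⟪p, (c : H)⟫ : ℝ) : EReal)

/-- `F : H → EReal` is proper (not identically `+∞`, never `−∞`),
lower-semicontinuous and convex. -/
def ProperLscConvexE (F : H → EReal) : Prop :=
  (∃ x, F x ≠ ⊤) ∧ (∀ x, F x ≠ ⊥) ∧ LowerSemicontinuous F ∧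
    ∀ x y (t : ℝ), 0 ≤ t → t ≤ 1 →
      F (t • x + (1 - t) • y) ≤ ((t : ℝ) : EReal) * F x + (((1 - t : ℝ)) : EReal) * F y

/-- Weak convergence of a sequence in a Hilbert space. -/
def WeakConv (x : ℕ → H) (p : H) : Prop :=
  ∀ y : H, Tendsto (fun n => ⟪x n, y⟫) atTop (𝓝 ⟪p, y⟫)

/-- A weak cluster point: weak limit of some subsequence. -/
def WeakClusterPt (x : ℕ → H) (p : H) : Prop :=
  ∃ φ : ℕ → ℕ, StrictMono φ ∧ WeakConv (x ∘ φ) p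

/-- Boundedly inf-compact function: intersections of balls and sublevel sets are
relatively compact. -/
def BddInfCompact (F : H → EReal) : Prop :=
  ∀ R M : ℝ, 0 ≤ R → IsCompact (closure {p : H | ‖p‖ ≤ R ∧ F p ≤ (M : EReal)})

/-- The data of the (SFBP) algorithm together with hypotheses (H₀). -/
structure SFBP (H : Type*) [NormedAddCommGroup H] [InnerProductSpace ℝ H]
    [CompleteSpace H] where
  /-- the maximal monotone operator -/
  A : H → Set H
  /-- the smooth potential -/
  Φ : H → ℝ
  /-- its gradient -/
  Φ' : H → H
  /-- the smooth penalization potential -/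
  Ψ₁ : H → ℝ
  /-- its gradient -/
  Ψ₁' : H → H
  /-- the nonsmooth penalization potential -/
  Ψ₂ : H → EReal
  /-- the constraint set -/
  C : Set H
  /-- the step sizes -/
  lam : ℕ → ℝ
  /-- the penalization parameters -/
  beta : ℕ → ℝ
  /-- Lipschitz constant of ∇Φ -/
  LΦ : ℝ
  /-- Lipschitz constant of ∇Ψ₁ -/
  LΨ₁ : ℝ
  /-- the sequence generated by the algorithm -/
  x : ℕ → H
  convΦ : ConvexOn ℝ Set.univ Φ
  gradΦ : ∀ p, HasGradientAt Φ (Φ' p) p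
  lipΦ : ∀ p q, ‖Φ' p - Φ' q‖ ≤ LΦ * ‖p - q‖
  convΨ₁ : ConvexOn ℝ Set.univ Ψ₁
  gradΨ₁ : ∀ p, HasGradientAt Ψ₁ (Ψ₁' p) p
  lipΨ₁ : ∀ p q, ‖Ψ₁' p - Ψ₁' q‖ ≤ LΨ₁ * ‖p - q‖
  properΨ₂ : ProperLscConvexE Ψ₂
  Ψ₁nonneg : ∀ p, 0 ≤ Ψ₁ p
  Ψ₂nonneg : ∀ p, (0 : EReal) ≤ Ψ₂ p
  minΨ₁ : ∃ p, Ψ₁ p = 0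
  minΨ₂ : ∃ p, Ψ₂ p = 0
  Cdef : C = {p | ∀ q, Ψ₁ p ≤ Ψ₁ q} ∩ {p | ∀ q, Ψ₂ p ≤ Ψ₂ q}
  Cne : C.Nonempty
  maxmonA : MaxMonotoneOp A
  maxmonT : MaxMonotoneOp
    (fun p => {w | ∃ za ∈ A p, ∃ v ∈ nCone C p, w = za + Φ' p + v})
  Sne : ∃ p, ∃ za ∈ A p, ∃ v ∈ nCone C p, za + Φ' p + v = 0
  lamPos : ∀ n, 0 < lam n
  betaPos : ∀ n, 0 < beta n
  lamDiv : Tendsto (fun N => ∑ k ∈ Finset.range N, lam k) atTop atTop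
  sumSq : Summable fun n => LΦ * lam n ^ 2
  limsupCond : ∃ γ : ℝ, γ < 2 ∧ ∀ᶠ n in atTop, LΨ₁ * (lam n * beta n) ≤ γ
  keyCond : ∀ z : H, (∃ u, z ∈ nCone C u) →
    ∃ M : ℝ, ∀ N : ℕ, ∑ n ∈ Finset.range N,
      (((lam n * beta n : ℝ)) : EReal) *
        (fenchelConj (fun q => ((Ψ₁ q : ℝ) : EReal) + Ψ₂ q) ((beta n)⁻¹ • z)
          - suppFun C ((beta n)⁻¹ • z)) ≤ (M : EReal)
  algo : ∀ n, ∃ a ∈ A (x (n + 1)), ∃ w ∈ ESubdiff Ψ₂ (x (n + 1)),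
    x n - x (n + 1) = lam n • (Φ' (x n) + beta n • Ψ₁' (x n) + a + beta n • w)

/-- The solution set `S = (A + ∇Φ + N_C)⁻¹(0)`. -/
def SFBP.S (d : SFBP H) : Set H :=
  {p | ∃ za ∈ d.A p, ∃ v ∈ nCone d.C p, za + d.Φ' p + v = 0}


lemma aux_seq_zero (A e lam : ℕ → ℝ) (c : ℝ) (hc : 0 < c) (hA : ∀ n, 0 ≤ A n)
    (he : ∀ n, 0 ≤ e n) (hes : Summable e) (hl : ∀ n, 0 < lam n)
    (hdiv : Tendsto (fun N => ∑ k ∈ Finset.range N, lam k) atTop atTop)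
    (h : ∀ n, A (n + 1) + c * lam n * A (n + 1) ≤ A n + e n) :
    Tendsto A atTop (𝓝 0) := by
  have hE : ∀ n, ∑ k ∈ Finset.range n, e k ≤ ∑' k, e k := fun n =>
    hes.sum_le_tsum _ (fun k _ => he k)
  have hanti : Antitone (fun n => A n - ∑ k ∈ Finset.range n, e k) := by
    apply antitone_nat_of_succ_le
    intro n
    rw [Finset.sum_range_succ]
    have := h n
    have h2 : 0 ≤ c * lam n * A (n + 1) :=
      mul_nonneg (mul_nonneg hc.le (hl n).le) (hA _)
    linarith
  have hbdd : BddBelow (Set.range (fun n => A n - ∑ k ∈ Finset.range n, e k)) := by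
    refine ⟨- ∑' k, e k, ?_⟩
    rintro _ ⟨n, rfl⟩
    have := hE n
    have := hA n
    simp only
    linarith
  have hlim := (tendsto_atTop_ciInf hanti hbdd).add hes.hasSum.tendsto_sum_nat
  simp only [sub_add_cancel] at hlim
  set l := (⨅ i, (A i - ∑ k ∈ Finset.range i, e k)) + ∑' k, e k with hldef
  have hl0 : 0 ≤ l := ge_of_tendsto' hlim hA
  rcases hl0.eq_or_lt with h0 | hpos
  · rw [h0]; exact hlim
  exfalso
  have hsum : ∀ n, A n + c * ∑ k ∈ Finset.range n, lam k * A (k + 1)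
      ≤ A 0 + ∑ k ∈ Finset.range n, e k := by
    intro n
    induction n with
    | zero => simp
    | succ n ih =>
      rw [Finset.sum_range_succ, Finset.sum_range_succ, mul_add]
      have := h n
      nlinarith
  have hev : ∀ᶠ n in atTop, l / 2 < A n := hlim.eventually (lt_mem_nhds (by linarith))
  obtain ⟨N, hN⟩ := eventually_atTop.1 hev
  have hlow : ∀ n, N ≤ n → (l / 2) * (∑ k ∈ Finset.range n, lam k
      - ∑ k ∈ Finset.range N, lam k) ≤ ∑ k ∈ Finset.range n, lam k * A (k + 1) := by
    intro n hn
    induction n, hn using Nat.le_induction with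
    | base =>
      simp only [sub_self, mul_zero]
      exact Finset.sum_nonneg (fun k _ => mul_nonneg (hl k).le (hA _))
    | succ n hn ih =>
      rw [Finset.sum_range_succ, Finset.sum_range_succ]
      have h1 := hN (n + 1) (by omega)
      have h2 := mul_le_mul_of_nonneg_left h1.le (hl n).le
      nlinarith
  set K := A 0 + ∑' k, e k with hK
  have hup : ∀ n, c * ∑ k ∈ Finset.range n, lam k * A (k + 1) ≤ K := by
    intro n
    have := hsum n
    have := hE n
    have := hA n
    linarith
  obtain ⟨n, hn1, hn2⟩ := ((hdiv.eventually_gt_atTop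
    (K / (c * (l / 2)) + ∑ k ∈ Finset.range N, lam k)).and (eventually_ge_atTop N)).exists
  have h1 := hlow n hn2
  have h2 := hup n
  have h3 : 0 < c * (l / 2) := by positivity
  have h4 : K / (c * (l / 2)) < ∑ k ∈ Finset.range n, lam k - ∑ k ∈ Finset.range N, lam k := by
    linarith
  rw [div_lt_iff₀ h3] at h4
  have h5 := mul_le_mul_of_nonneg_left h1 hc.le
  nlinarith

lemma aux_seq_zero_exp (a b e lam : ℕ → ℝ) (c : ℝ) (hc : 0 < c) (ha : ∀ n, 0 ≤ a n)
    (hb : ∀ n, 0 ≤ b n) (hbs : Summable b)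
    (he : ∀ n, 0 ≤ e n) (hes : Summable e) (hl : ∀ n, 0 < lam n)
    (hdiv : Tendsto (fun N => ∑ k ∈ Finset.range N, lam k) atTop atTop)
    (h : ∀ n, a (n + 1) + c * lam n * a (n + 1) ≤ (1 + b n) * a n + e n) :
    Tendsto a atTop (𝓝 0) := by
  have key := aux_seq_zero (fun n => a n * Real.exp (-∑ k ∈ Finset.range n, b k)) e lam c hc
    (fun n => mul_nonneg (ha n) (Real.exp_pos _).le) he hes hl hdiv (by
      intro n
      set q := Real.exp (-∑ k ∈ Finset.range (n + 1), b k) with hq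
      have hq0 : 0 < q := Real.exp_pos _
      have hq1 : q ≤ 1 := by
        rw [hq, Real.exp_le_one_iff, neg_nonpos]
        exact Finset.sum_nonneg (fun k _ => hb k)
      have hqn : Real.exp (-∑ k ∈ Finset.range n, b k) = q * Real.exp (b n) := by
        rw [hq, ← Real.exp_add, Finset.sum_range_succ]
        congr 1
        ring
      rw [hqn]
      have h1 : 1 + b n ≤ Real.exp (b n) := by
        have := Real.add_one_le_exp (b n)
        linarith
      have h2 := mul_le_mul_of_nonneg_right h1 (ha n)
      have h3 := mul_le_mul_of_nonneg_right ((h n).trans (add_le_add_left h2 (e n))) hq0.le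
      have h4 := mul_le_mul_of_nonneg_left hq1 (he n)
      nlinarith)
  have hB : ∀ n, ∑ k ∈ Finset.range n, b k ≤ ∑' k, b k := fun n =>
    hbs.sum_le_tsum _ (fun k _ => hb k)
  have key2 := key.mul_const (Real.exp (∑' k, b k))
  rw [zero_mul] at key2
  refine squeeze_zero ha (fun n => ?_) key2
  rw [mul_assoc, ← Real.exp_add]
  have : 1 ≤ Real.exp (-∑ k ∈ Finset.range n, b k + ∑' k, b k) := by
    rw [Real.one_le_exp_iff]
    have := hB n
    linarith
  nlinarith [ha n]

lemma aux_line {f : H → ℝ} {f' : H → H} (hg : ∀ p, HasGradientAt f (f' p) p) (x d : H) (t : ℝ) :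
    HasDerivAt (fun s : ℝ => f (x + s • d)) ⟪f' (x + t • d), d⟫ t := by
  have h1 : HasDerivAt (fun s : ℝ => x + s • d) d t := by
    simpa using ((hasDerivAt_id t).smul_const d).const_add x
  have h2 := (hg (x + t • d)).hasFDerivAt.comp_hasDerivAt t h1
  rw [InnerProductSpace.toDual_apply_apply] at h2
  exact h2

lemma aux_grad_ineq {f : H → ℝ} {f' : H → H} (hc : ConvexOn ℝ Set.univ f)
    (hg : ∀ p, HasGradientAt f (f' p) p) (x y : H) : f x + ⟪f' x, y - x⟫ ≤ f y := by
  have hc' : ConvexOn ℝ Set.univ (fun s : ℝ => f (x + s • (y - x))) := by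
    have h := hc.comp_affineMap (AffineMap.lineMap x y : ℝ →ᵃ[ℝ] H)
    have e : (f ∘ (AffineMap.lineMap x y : ℝ →ᵃ[ℝ] H)) = (fun s : ℝ => f (x + s • (y - x))) := by
      funext s
      simp [AffineMap.lineMap_apply, add_comm]
    rw [e] at h
    simpa using h
  have h := hc'.le_slope_of_hasDerivAt (Set.mem_univ 0) (Set.mem_univ 1) one_pos
    (aux_line hg x (y - x) 0)
  simp [slope_def_field] at h
  linarith

lemma aux_descent {f : H → ℝ} {f' : H → H} {L : ℝ}
    (hg : ∀ p, HasGradientAt f (f' p) p) (hL : ∀ p q, ‖f' p - f' q‖ ≤ L * ‖p - q‖) (x d : H) :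
    f (x + d) ≤ f x + ⟪f' x, d⟫ + L / 2 * ‖d‖ ^ 2 := by
  have hd : ∀ t : ℝ, HasDerivAt
      (fun s : ℝ => f (x + s • d) - s * ⟪f' x, d⟫ - s ^ 2 * (L / 2 * ‖d‖ ^ 2))
      (⟪f' (x + t • d), d⟫ - ⟪f' x, d⟫ - 2 * t * (L / 2 * ‖d‖ ^ 2)) t := by
    intro t
    have h1 := (aux_line hg x d t).sub ((hasDerivAt_id t).mul_const ⟪f' x, d⟫)
    have h2 := h1.sub ((hasDerivAt_pow 2 t).mul_const (L / 2 * ‖d‖ ^ 2))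
    refine h2.congr_deriv ?_
    simp
  have hanti := antitoneOn_of_deriv_nonpos (convex_Icc (0 : ℝ) 1)
    (fun t _ => (hd t).continuousAt.continuousWithinAt)
    (fun t _ => (hd t).differentiableAt.differentiableWithinAt) (by
      intro t ht
      rw [interior_Icc] at ht
      rw [(hd t).deriv]
      have h1 : ⟪f' (x + t • d) - f' x, d⟫ ≤ ‖f' (x + t • d) - f' x‖ * ‖d‖ :=
        real_inner_le_norm _ _
      have h2 := hL (x + t • d) x
      rw [add_sub_cancel_left, norm_smul, Real.norm_of_nonneg ht.1.le] at h2
      have h3 := mul_le_mul_of_nonneg_right h2 (norm_nonneg d)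
      rw [inner_sub_left] at h1
      nlinarith)
  have h := hanti (Set.left_mem_Icc.2 zero_le_one) (Set.right_mem_Icc.2 zero_le_one) zero_le_one
  simp at h
  linarith

/-- Estimate on the smooth penalization term. -/
lemma aux_smooth {f : H → ℝ} {f' : H → H} {L : ℝ} (hc : ConvexOn ℝ Set.univ f)
    (hg : ∀ p, HasGradientAt f (f' p) p) (hL : ∀ p q, ‖f' p - f' q‖ ≤ L * ‖p - q‖)
    (hf : ∀ p, 0 ≤ f p) (x y u : H) (hu : f u = 0) (t γ θ : ℝ) (ht : 0 < t) (hγ : 1 ≤ γ)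
    (hs : L * t ≤ γ) (hθ : 0 < θ) (hθ1 : θ ≤ 1) (hθγ : γ * (1 + θ) + 2 * θ ≤ 2) :
    2 * t * θ * f y ≤ (1 - θ) * ‖x - y‖ ^ 2 + 2 * t * ⟪f' x, y - u⟫ := by
  have hgu : f' u = 0 := by
    have hmin : IsLocalMin f u := Filter.Eventually.of_forall (fun p => by rw [hu]; exact hf p)
    have h := hmin.hasFDerivAt_eq_zero (hg u).hasFDerivAt
    simpa using h
  set g := f' x with hgdef
  set τ := t / γ with hτ
  have hγ0 : 0 < γ := by linarith
  have h1 := aux_grad_ineq hc hg x (u + τ • g)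
  have h2 := aux_descent hg hL u (τ • g)
  have h3 := aux_descent hg hL x (-(τ • g))
  have h4 := aux_descent hg hL x (y - x)
  have h5 := hf (x + -(τ • g))
  have h6 := aux_grad_ineq hc hg x u
  rw [hgu, hu, inner_zero_left, norm_smul, mul_pow, Real.norm_eq_abs, sq_abs] at h2
  rw [norm_neg, norm_smul, mul_pow, Real.norm_eq_abs, sq_abs, inner_neg_right,
    real_inner_smul_right, real_inner_self_eq_norm_sq] at h3
  rw [add_sub_cancel] at h4
  rw [add_sub_right_comm, inner_add_right, real_inner_smul_right,
    real_inner_self_eq_norm_sq] at h1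
  rw [hu] at h6
  simp only [← hgdef] at h1 h2 h3 h4 h6
  have e1 : ⟪g, y - u⟫ = ⟪g, y - x⟫ - ⟪g, u - x⟫ := by
    rw [← inner_sub_right]; congr 1; abel
  have e2 : ‖x - y‖ = ‖y - x‖ := norm_sub_rev _ _
  rw [e1, e2]
  have hCS : -(‖g‖ * ‖y - x‖) ≤ ⟪g, y - x⟫ := by
    have := abs_real_inner_le_norm g (y - x)
    exact (abs_le.1 this).1
  set G := ‖g‖
  set D := ‖y - x‖
  set I := ⟪g, y - x⟫
  set J := ⟪g, u - x⟫
  -- cocoercivity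
  have hLτ : L * τ ≤ 1 := by
    rw [hτ, ← mul_div_assoc, div_le_one hγ0]; exact hs
  have hτ0 : 0 < τ := div_pos ht hγ0
  have hco : τ * G ^ 2 ≤ -J := by
    have : L * τ * (τ * G ^ 2) ≤ 1 * (τ * G ^ 2) :=
      mul_le_mul_of_nonneg_right hLτ (by positivity)
    nlinarith
  have htτ : t = γ * τ := by rw [hτ]; field_simp
  have hJ : f x ≤ -J := by linarith
  have hfy : 2 * t * θ * f y ≤ 2 * t * θ * (-J + I + L / 2 * D ^ 2) :=
    mul_le_mul_of_nonneg_left (by linarith) (by positivity)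
  have hLt : L * t * (θ * D ^ 2) ≤ γ * (θ * D ^ 2) :=
    mul_le_mul_of_nonneg_right hs (by positivity)
  have hA : 2 * t * (1 - θ) * (τ * G ^ 2) ≤ 2 * t * (1 - θ) * (-J) :=
    mul_le_mul_of_nonneg_left hco (mul_nonneg (by positivity) (by linarith))
  have hB : 2 * t * (1 - θ) * (-(G * D)) ≤ 2 * t * (1 - θ) * I :=
    mul_le_mul_of_nonneg_left hCS (mul_nonneg (by positivity) (by linarith))
  have hq : 0 ≤ (1 - θ - γ * θ) * D ^ 2 + 2 * t * (1 - θ) * (τ * G ^ 2)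
      - 2 * t * (1 - θ) * (G * D) := by
    have hc1 : (1 - θ) * γ / 2 ≤ 1 - θ - γ * θ := by nlinarith
    have hc2 := mul_le_mul_of_nonneg_right hc1 (sq_nonneg D)
    have hc3 : 0 ≤ (1 - θ) * γ / 2 * (D - 2 * τ * G) ^ 2 :=
      mul_nonneg (div_nonneg (mul_nonneg (by linarith) hγ0.le) (by norm_num)) (sq_nonneg _)
    rw [htτ]
    nlinarith
  nlinarith

/-- Real-valued consequences of the key summability condition. -/
lemma aux_key (d : SFBP H) (u z : H) (hz : z ∈ nCone d.C u) :
    ∃ e : ℕ → ℝ, (∀ n, 0 ≤ e n) ∧ Summable e ∧ ∀ n (y : H) (r : ℝ), d.Ψ₂ y = (r : EReal) →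
      d.lam n * ⟪z, y - u⟫ - d.lam n * d.beta n * (d.Ψ₁ y + r) ≤ e n := by
  obtain ⟨huC, hzc⟩ := hz
  have hu1 : d.Ψ₁ u = 0 := by
    rw [d.Cdef] at huC
    obtain ⟨p, hp⟩ := d.minΨ₁
    exact le_antisymm (hp ▸ huC.1 p) (d.Ψ₁nonneg u)
  have hu2 : d.Ψ₂ u = 0 := by
    rw [d.Cdef] at huC
    obtain ⟨p, hp⟩ := d.minΨ₂
    exact le_antisymm (hp ▸ huC.2 p) (d.Ψ₂nonneg u)
  obtain ⟨M, hM⟩ := d.keyCond z ⟨u, huC, hzc⟩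
  have hsupp : ∀ n, suppFun d.C ((d.beta n)⁻¹ • z)
      = ((⟪(d.beta n)⁻¹ • z, u⟫ : ℝ) : EReal) := by
    intro n
    apply le_antisymm
    · refine iSup_le fun c => ?_
      rw [EReal.coe_le_coe_iff, real_inner_smul_left, real_inner_smul_left]
      have := hzc c c.2
      rw [inner_sub_right] at this
      exact mul_le_mul_of_nonneg_left (by linarith) (inv_nonneg.2 (d.betaPos n).le)
    · exact le_iSup (fun c : d.C => ((⟪(d.beta n)⁻¹ • z, (c : H)⟫ : ℝ) : EReal)) ⟨u, huC⟩
  set F : ℕ → EReal := fun n => (((d.lam n * d.beta n : ℝ)) : EReal) *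
        (fenchelConj (fun q => ((d.Ψ₁ q : ℝ) : EReal) + d.Ψ₂ q) ((d.beta n)⁻¹ • z)
          - suppFun d.C ((d.beta n)⁻¹ • z)) with hF
  have hlow : ∀ n (y : H) (r : ℝ), d.Ψ₂ y = (r : EReal) →
      ((d.lam n * ⟪z, y - u⟫ - d.lam n * d.beta n * (d.Ψ₁ y + r) : ℝ) : EReal) ≤ F n := by
    intro n y r hr
    have h1 : (((⟪y, (d.beta n)⁻¹ • z⟫ : ℝ) : EReal) - (((d.Ψ₁ y : ℝ) : EReal) + d.Ψ₂ y))
        ≤ fenchelConj (fun q => ((d.Ψ₁ q : ℝ) : EReal) + d.Ψ₂ q) ((d.beta n)⁻¹ • z) :=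
      le_iSup (fun y => (((⟪y, (d.beta n)⁻¹ • z⟫ : ℝ) : EReal)
        - (((d.Ψ₁ y : ℝ) : EReal) + d.Ψ₂ y))) y
    rw [hr] at h1
    have h2 := EReal.sub_le_sub h1 (le_refl (suppFun d.C ((d.beta n)⁻¹ • z)))
    have hlb : 0 < d.lam n * d.beta n := mul_pos (d.lamPos n) (d.betaPos n)
    have h3 := mul_le_mul_of_nonneg_left h2 (EReal.coe_nonneg.2 hlb.le)
    refine le_trans (le_of_eq ?_) h3
    rw [hsupp]
    norm_cast
    rw [real_inner_smul_right, real_inner_smul_left, inner_sub_right, real_inner_comm z y]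
    have := (d.betaPos n).ne'
    field_simp
    ring
  have hnn : ∀ n, 0 ≤ F n := by
    intro n
    have := hlow n u 0 (by simpa using hu2)
    simpa [hu1] using this
  have hbd : ∀ n, F n ≤ (M : EReal) := by
    intro n
    refine le_trans ?_ (hM (n + 1))
    exact Finset.single_le_sum (f := F) (fun k _ => hnn k) (Finset.mem_range.2 (Nat.lt_succ_self n))
  have hcoe : ∀ n, ((F n).toReal : EReal) = F n := fun n =>
    EReal.coe_toReal (ne_top_of_le_ne_top (EReal.coe_ne_top M) (hbd n))
      (ne_bot_of_le_ne_bot EReal.zero_ne_bot (hnn n))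
  refine ⟨fun n => (F n).toReal, fun n => EReal.toReal_nonneg (hnn n), ?_, ?_⟩
  · refine summable_of_sum_range_le (c := M) (fun n => EReal.toReal_nonneg (hnn n)) ?_
    intro N
    have hcs : ∀ N, ((∑ k ∈ Finset.range N, (F k).toReal : ℝ) : EReal)
        = ∑ k ∈ Finset.range N, F k := by
      intro N
      induction N with
      | zero => simp
      | succ N ih => rw [Finset.sum_range_succ, Finset.sum_range_succ, EReal.coe_add, ih, hcoe]
    rw [← EReal.coe_le_coe_iff, hcs]
    exact hM N
  · intro n y r hr
    rw [← EReal.coe_le_coe_iff]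
    show _ ≤ ((F n).toReal : EReal)
    rw [hcoe]
    exact hlow n y r hr

lemma aux_conv (d : SFBP H) (α : ℝ) (hα : 0 < α)
    (hsm : ∀ p q p' q', p' ∈ d.A p → q' ∈ d.A q →
      α * ‖p - q‖ ^ 2 ≤ ⟪p' - q', p - q⟫) (u : H) (hu : u ∈ d.S) :
    Filter.Tendsto d.x Filter.atTop (𝓝 u) := by
  obtain ⟨za, hza, v, ⟨huC, hvc⟩, hzero⟩ := hu
  have hu1 : d.Ψ₁ u = 0 := by
    rw [d.Cdef] at huC
    obtain ⟨p, hp⟩ := d.minΨ₁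
    exact le_antisymm (hp ▸ huC.1 p) (d.Ψ₁nonneg u)
  have hu2 : d.Ψ₂ u = 0 := by
    rw [d.Cdef] at huC
    obtain ⟨p, hp⟩ := d.minΨ₂
    exact le_antisymm (hp ▸ huC.2 p) (d.Ψ₂nonneg u)
  obtain ⟨γ₀, hγ₀, hev⟩ := d.limsupCond
  obtain ⟨γ, hγ1, hγ2, hγle⟩ : ∃ γ : ℝ, 1 ≤ γ ∧ γ < 2 ∧ γ₀ ≤ γ :=
    ⟨max γ₀ 1, le_max_right _ _, max_lt hγ₀ (by norm_num), le_max_left _ _⟩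
  obtain ⟨θ, hθ0, hθ1, hθγ⟩ : ∃ θ : ℝ, 0 < θ ∧ θ ≤ 1 ∧ γ * (1 + θ) + 2 * θ ≤ 2 := by
    refine ⟨(2 - γ) / (2 + γ), div_pos (by linarith) (by linarith), ?_, ?_⟩
    · rw [div_le_one (by linarith)]; linarith
    · have : 2 + γ ≠ 0 := by linarith
      apply le_of_eq
      field_simp
      ring
  have hz : θ⁻¹ • v ∈ nCone d.C u := by
    refine ⟨huC, fun c hc => ?_⟩
    rw [real_inner_smul_left]
    exact mul_nonpos_of_nonneg_of_nonpos (inv_nonneg.2 hθ0.le) (hvc c hc)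
  obtain ⟨e, he0, hes, hekey⟩ := aux_key d u _ hz
  obtain ⟨N, hN⟩ := eventually_atTop.1 hev
  have step : ∀ n, N ≤ n → ‖d.x (n + 1) - u‖ ^ 2 + 2 * α * d.lam n * ‖d.x (n + 1) - u‖ ^ 2
      ≤ (1 + d.LΦ ^ 2 * d.lam n ^ 2 / θ) * ‖d.x n - u‖ ^ 2 + 2 * θ * e n := by
    intro n hn
    obtain ⟨a, ha, w, hw, hxy⟩ := d.algo n
    set x := d.x n
    set y := d.x (n + 1)
    have hl := d.lamPos n
    have hb := d.betaPos n
    have hmono := hsm y u a za ha hza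
    set l := d.lam n
    set b := d.beta n
    have hwu := hw u
    rw [hu2] at hwu
    have hr : ∃ r : ℝ, d.Ψ₂ y = (r : EReal) := by
      refine ⟨(d.Ψ₂ y).toReal, (EReal.coe_toReal ?_ (d.properΨ₂.2.1 y)).symm⟩
      intro htop
      rw [htop, EReal.top_add_coe] at hwu
      simp at hwu
    obtain ⟨r, hr⟩ := hr
    have hr0 : 0 ≤ r := by
      have := d.Ψ₂nonneg y
      rw [hr] at this
      exact_mod_cast this
    rw [hr] at hwu
    have hwu' : r + ⟪w, u - y⟫ ≤ 0 := by exact_mod_cast hwu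
    have hk := hekey n y r hr
    have hsm1 := aux_smooth d.convΨ₁ d.gradΨ₁ d.lipΨ₁ d.Ψ₁nonneg x y u hu1 (l * b) γ θ
      (mul_pos hl hb) hγ1 ((hN n hn).trans hγle) hθ0 hθ1 hθγ
    have hΦ1 := aux_grad_ineq d.convΦ d.gradΦ x u
    have hΦ2 := aux_grad_ineq d.convΦ d.gradΦ u x
    have hΦ3 : -(d.LΦ * ‖x - u‖ * ‖x - y‖) ≤ ⟪d.Φ' x - d.Φ' u, y - x⟫ := by
      have h1 := (abs_le.1 (abs_real_inner_le_norm (d.Φ' x - d.Φ' u) (y - x))).1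
      have h2 := mul_le_mul_of_nonneg_right (d.lipΦ x u) (norm_nonneg (y - x))
      rw [norm_sub_rev x y]
      linarith
    have hΦ : -(d.LΦ * ‖x - u‖ * ‖x - y‖) ≤ ⟪d.Φ' x, y - u⟫ - ⟪d.Φ' u, y - u⟫ := by
      have e1 : ⟪d.Φ' x, y - u⟫ - ⟪d.Φ' u, y - u⟫ = ⟪d.Φ' x - d.Φ' u, y - x⟫
          - ⟪d.Φ' x, u - x⟫ - ⟪d.Φ' u, x - u⟫ := by
        simp only [inner_sub_left, inner_sub_right]
        ring
      rw [e1]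
      linarith
    have hza' : ⟪za, y - u⟫ = -⟪d.Φ' u, y - u⟫ - ⟪v, y - u⟫ := by
      have : za = -d.Φ' u - v := by
        have h0 : za + (d.Φ' u + v) = 0 := by rw [← add_assoc]; exact hzero
        rw [eq_neg_of_add_eq_zero_left h0]; abel
      rw [this, inner_sub_left, inner_neg_left]
    have hinner : ⟪x - y, y - u⟫ = l * (⟪d.Φ' x, y - u⟫ + b * ⟪d.Ψ₁' x, y - u⟫
        + ⟪a, y - u⟫ + b * ⟪w, y - u⟫) := by
      rw [hxy]
      simp only [real_inner_smul_left, inner_add_left]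
    have hpol : ‖x - u‖ ^ 2 = ‖x - y‖ ^ 2 + 2 * ⟪x - y, y - u⟫ + ‖y - u‖ ^ 2 := by
      rw [← norm_add_sq_real, sub_add_sub_cancel]
    have hw2 : ⟪w, u - y⟫ = -⟪w, y - u⟫ := by rw [← inner_neg_right, neg_sub]
    rw [inner_sub_left] at hmono
    rw [real_inner_smul_left] at hk
    have hk' : l * ⟪v, y - u⟫ ≤ θ * (l * b * (d.Ψ₁ y + r)) + θ * e n := by
      have := mul_le_mul_of_nonneg_left hk hθ0.le
      have e1 : θ * (l * (θ⁻¹ * ⟪v, y - u⟫) - l * b * (d.Ψ₁ y + r))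
        = l * ⟪v, y - u⟫ - θ * (l * b * (d.Ψ₁ y + r)) := by
        field_simp
      linarith
    have hY : 2 * (l * (d.LΦ * ‖x - u‖ * ‖x - y‖)) ≤
        θ * ‖x - y‖ ^ 2 + d.LΦ ^ 2 * l ^ 2 / θ * ‖x - u‖ ^ 2 := by
      have h0 : 0 ≤ (θ * ‖x - y‖ - d.LΦ * l * ‖x - u‖) ^ 2 / θ :=
        div_nonneg (sq_nonneg _) hθ0.le
      have e1 : (θ * ‖x - y‖ - d.LΦ * l * ‖x - u‖) ^ 2 / θ = θ * ‖x - y‖ ^ 2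
          + d.LΦ ^ 2 * l ^ 2 / θ * ‖x - u‖ ^ 2 - 2 * (l * (d.LΦ * ‖x - u‖ * ‖x - y‖)) := by
        field_simp
        ring
      linarith
    have hrr : θ * (l * b * r) ≤ l * b * r := by
      have : 0 ≤ l * b * r := by positivity
      nlinarith
    have hww : l * b * r ≤ l * b * ⟪w, y - u⟫ :=
      mul_le_mul_of_nonneg_left (by linarith) (by positivity)
    have hΦl := mul_le_mul_of_nonneg_left hΦ hl.le
    have hml := mul_le_mul_of_nonneg_left hmono hl.le
    rw [hza'] at hml
    linarith
  -- conclusion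
  have hsq : Tendsto (fun n => ‖d.x (n + N) - u‖ ^ 2) atTop (𝓝 0) := by
    refine aux_seq_zero_exp (fun n => ‖d.x (n + N) - u‖ ^ 2)
      (fun n => d.LΦ ^ 2 * d.lam (n + N) ^ 2 / θ) (fun n => 2 * θ * e (n + N))
      (fun n => d.lam (n + N)) (2 * α) (by positivity) (fun n => by positivity)
      (fun n => by positivity) ?_ (fun n => mul_nonneg (by positivity) (he0 _)) ?_
      (fun n => d.lamPos _) ?_ ?_
    · have h1 := ((summable_nat_add_iff N).2 d.sumSq).mul_left (d.LΦ / θ)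
      refine h1.congr (fun n => ?_)
      ring
    · exact ((summable_nat_add_iff N).2 hes).mul_left _
    · have h1 := (tendsto_atTop_add_const_right atTop (-∑ k ∈ Finset.range N, d.lam k)
        (d.lamDiv.comp (tendsto_add_atTop_nat N)))
      refine h1.congr (fun n => ?_)
      simp only [Function.comp]
      rw [add_comm n N, Finset.sum_range_add]
      simp only [add_comm N]
      ring
    · intro n
      have := step (n + N) (by omega)
      rw [show n + 1 + N = n + N + 1 by omega]
      exact this
  have hsq2 := (tendsto_add_atTop_iff_nat (f := fun n => ‖d.x n - u‖ ^ 2) N).1 hsq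
  rw [tendsto_iff_norm_sub_tendsto_zero]
  have h := (Real.continuous_sqrt.tendsto 0).comp hsq2
  simpa [Function.comp_def, Real.sqrt_sq (norm_nonneg _)] using h

/-- **Theorem 2.2, strongly monotone case.** Under (H₀), if `A` is strongly monotone
with parameter `α > 0`, then `S` is a singleton `{u}` and the sequence `(x_n)`
converges strongly to `u`. -/
theorem sfbp_strong_of_stronglyMonotone (d : SFBP H) (α : ℝ) (hα : 0 < α)
    (hsm : ∀ p q p' q', p' ∈ d.A p → q' ∈ d.A q →
      α * ‖p - q‖ ^ 2 ≤ ⟪p' - q', p - q⟫) :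
    ∃ u, d.S = {u} ∧ Filter.Tendsto d.x Filter.atTop (𝓝 u) := by
  obtain ⟨u, hu⟩ := d.Sne
  refine ⟨u, ?_, aux_conv d α hα hsm u hu⟩
  ext p
  rw [Set.mem_singleton_iff]
  constructor
  · intro hp
    exact tendsto_nhds_unique (aux_conv d α hα hsm p hp) (aux_conv d α hα hsm u hu)
  · rintro rfl
    exact hu
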